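/- Let F be a free group on a set X, and let w be a nonempty cyclically reduced word in X and inverses. If for some n ≥ 1 both a word u and its inverse u⁻¹ appear as subwords of the cyclic word w^n, then the length of u satisfies |u| ≤ |w|/2. -/

import Mathlib

/-- A word in `X` and inverses is reduced if it contains no adjacent pair of
the form `x x⁻¹` or `x⁻¹ x`. -/
def WordReduced {X : Type*} (w : List (X × Bool)) : Prop :=
  List.Chain' (fun a b => a.1 = b.1 → a.2 = b.2) w

/-- A word is cyclically reduced if it is reduced and additionally its first
letter is not the inverse of its last letter. -/
def WordCyclicallyReduced {X : Type*} (w : List (X × Bool)) : Prop :=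
  WordReduced w ∧ ∀ a b : X × Bool, w.head? = some a → w.getLast? = some b →
    (b.1 = a.1 → b.2 = a.2)

/-- The formal inverse of a word: reverse it and invert each letter. -/
def wordInv {X : Type*} (w : List (X × Bool)) : List (X × Bool) :=
  (w.map fun p => (p.1, !p.2)).reverse

/-- `u` appears as a subword of `w` considered as a cyclic word: `u` is a
contiguous subword of some cyclic permutation of `w`. -/
def IsCyclicSubword {X : Type*} (u w : List (X × Bool)) : Prop :=
  ∃ k : ℕ, u <:+: w.rotate k

theorem length_wordInv {X : Type*} (u : List (X × Bool)) : (wordInv u).length = u.length := by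
  simp [wordInv]

theorem getElem?_wordInv {X : Type*} (u : List (X × Bool)) {j : ℕ} (hj : j < u.length) :
    (wordInv u)[u.length - 1 - j]? = u[j]?.map fun p => (p.1, !p.2) := by
  rw [wordInv, List.getElem?_reverse (by simp; omega), List.getElem?_map, List.length_map]
  congr 2
  omega

theorem List.getElem?_flatten_replicate_mod {α : Type*} (w : List α) (n : ℕ) {i : ℕ}
    (hi : i < n * w.length) : (List.replicate n w).flatten[i]? = w[i % w.length]? := by
  induction n generalizing i with
  | zero => simp at hi
  | succ n ih =>
    rw [List.replicate_succ, List.flatten_cons]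
    rcases lt_or_ge i w.length with h | h
    · rw [List.getElem?_append_left h, Nat.mod_eq_of_lt h]
    · rw [List.getElem?_append_right h, ih (by rw [Nat.succ_mul] at hi; omega),
        ← Nat.mod_eq_sub_mod h]

theorem IsCyclicSubword.exists_getElem?_eq {X : Type*} {u w : List (X × Bool)} {n : ℕ}
    (h : IsCyclicSubword u (List.replicate n w).flatten) :
    ∃ a : ℕ, ∀ j < u.length, u[j]? = w[(a + j) % w.length]? := by
  obtain ⟨k, s, t, h⟩ := h
  refine ⟨s.length + k, fun j hj => ?_⟩
  have hlen : (List.replicate n w).flatten.length = n * w.length := by simp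
  have hl := congrArg List.length h
  simp only [List.length_append, List.length_rotate, hlen] at hl
  have hget := congrArg (fun l => l[s.length + j]?) h
  rw [List.getElem?_append_left (by simp; omega), List.getElem?_append_right (by omega),
    List.getElem?_rotate (by omega), hlen, List.getElem?_flatten_replicate_mod w n
      (Nat.mod_lt _ (by omega)), Nat.mod_mul_left_mod] at hget
  rw [Nat.add_sub_cancel_left] at hget
  rw [hget]
  congr 2
  omega

theorem WordCyclicallyReduced.snd_eq_of_getElem?_mod {X : Type*} {w : List (X × Bool)}
    (hcr : WordCyclicallyReduced w) (i : ℕ) {x y : X × Bool}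
    (hx : w[i % w.length]? = some x) (hy : w[(i + 1) % w.length]? = some y)
    (hxy : x.1 = y.1) : x.2 = y.2 := by
  obtain ⟨hr, hc⟩ := hcr
  obtain ⟨hi, rfl⟩ := List.getElem?_eq_some_iff.1 hx
  rcases Nat.lt_or_ge (i % w.length + 1) w.length with h | h
  · have e : (i + 1) % w.length = i % w.length + 1 := by
      rw [← Nat.mod_add_mod, Nat.mod_eq_of_lt h]
    simp only [e] at hy
    obtain ⟨_, rfl⟩ := List.getElem?_eq_some_iff.1 hy
    exact List.isChain_iff_getElem.1 hr _ h hxy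
  · have e' : i % w.length + 1 = w.length := by omega
    have e : (i + 1) % w.length = 0 := by rw [← Nat.mod_add_mod, e', Nat.mod_self]
    rw [e] at hy
    refine hc y _ (by rw [List.head?_eq_getElem?, hy]) ?_ hxy
    rw [List.getLast?_eq_getElem?, ← hx]
    congr 1
    omega

theorem two_mul_length_lt_of_isCyclicSubword_wordInv {X : Type*} {w : List (X × Bool)}
    (hw : w ≠ []) (hcr : WordCyclicallyReduced w) {n : ℕ} {u : List (X × Bool)}
    (hu : IsCyclicSubword u (List.replicate n w).flatten)
    (hu' : IsCyclicSubword (wordInv u) (List.replicate n w).flatten) :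
    2 * u.length < w.length := by
  by_contra! hL
  have hm : 0 < w.length := List.length_pos_iff.2 hw
  obtain ⟨a, ha⟩ := hu.exists_getElem?_eq
  obtain ⟨b, hb⟩ := hu'.exists_getElem?_eq
  rw [length_wordInv] at hb
  obtain ⟨t, ht, hmod⟩ : ∃ t < w.length, a + t ≡ b + (u.length - 1) [MOD w.length] := by
    refine ⟨(b + (u.length - 1) + a * (w.length - 1)) % w.length, Nat.mod_lt _ hm, ?_⟩
    refine ((Nat.mod_modEq _ _).add_left a).trans ?_
    have e : a + (b + (u.length - 1) + a * (w.length - 1))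
        = b + (u.length - 1) + a * w.length := by
      obtain ⟨m, hm'⟩ := Nat.exists_eq_add_of_lt hm
      rw [hm']
      simp only [zero_add, Nat.add_sub_cancel]
      ring
    rw [e]
    simp [Nat.ModEq]
  have hp : t / 2 < u.length := by omega
  have hinv := getElem?_wordInv u hp
  rw [hb _ (by omega), ha _ hp] at hinv
  have hpos : (b + (u.length - 1 - t / 2)) % w.length = (a + (t - t / 2)) % w.length := by
    refine (Nat.ModEq.add_right_cancel' (t / 2) ?_).symm
    convert hmod using 1 <;> omega
  rw [hpos] at hinv
  obtain ⟨x, hx⟩ : ∃ x, w[(a + t / 2) % w.length]? = some x :=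
    ⟨_, List.getElem?_eq_getElem (Nat.mod_lt _ hm)⟩
  rw [hx, Option.map_some] at hinv
  rcases Nat.even_or_odd' t with ⟨q, rfl | rfl⟩
  · rw [show 2 * q - 2 * q / 2 = 2 * q / 2 by omega, hx] at hinv
    simpa using congrArg Prod.snd (Option.some.inj hinv)
  · rw [show a + (2 * q + 1 - (2 * q + 1) / 2) = a + (2 * q + 1) / 2 + 1 by omega] at hinv
    simpa using hcr.snd_eq_of_getElem?_mod _ hx hinv rfl

theorem subword_length_le_of_cyclically_reduced_freeGroup
    {X : Type*} (w : List (X × Bool)) (hw : w ≠ [])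
    (hcr : WordCyclicallyReduced w) (n : ℕ) (hn : 1 ≤ n)
    (u : List (X × Bool))
    (hu : IsCyclicSubword u (List.flatten (List.replicate n w)))
    (hu' : IsCyclicSubword (wordInv u) (List.flatten (List.replicate n w))) :
    (u.length : ℝ) ≤ (w.length : ℝ) / 2 := by
  have h := two_mul_length_lt_of_isCyclicSubword_wordInv hw hcr hu hu'
  have h_cast : (2 : ℝ) * u.length < w.length := by exact_mod_cast h
  linarith
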